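/- Let φ be a formula with reversal with exactly m ≥ 0 two-way variables and exactly n one-way variables, where n ≤ 2. Then φ is unavoidable if and only if φ divides the Zimin formula with reversal Z_{m,n}. -/

import Mathlib

/-!
Formalization framework: a variable alphabet `Σ` is a type `V`; the letter
`(x, false)` represents the variable `x` and `(x, true)` represents its mirror
image `x^R`.  A pattern with reversal is a `List (V × Bool)`, and a formula
with reversal is a set of such patterns (finiteness and nonemptiness of
fragments are taken as hypotheses where relevant).  A morphism respecting
reversal is determined by its values `h : V → List A` on plain variables.
-/

/-- The image of a pattern with reversal under the reversal-respecting extension of `h`. -/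
def applyRev {V A : Type*} (h : V → List A) (p : List (V × Bool)) : List A :=
  p.flatMap fun z => if z.2 then (h z.1).reverse else h z.1

/-- A morphism is non-erasing if it sends no variable to the empty word. -/
def NonErasing {V A : Type*} (h : V → List A) : Prop := ∀ x, h x ≠ []

/-- A formula with reversal `φ` occurs in a finite word `w`. -/
def OccursIn {V A : Type*} (φ : Set (List (V × Bool))) (w : List A) : Prop :=
  ∃ h : V → List A, NonErasing h ∧ ∀ p ∈ φ, applyRev h p <:+: w

/-- A formula with reversal is avoidable: over some finite alphabet,
infinitely many finite words avoid it. -/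
def FAvoidable {V : Type*} (φ : Set (List (V × Bool))) : Prop :=
  ∃ A : Type, Finite A ∧ {w : List A | ¬ OccursIn φ w}.Infinite

/-- The Zimin formulas with reversal `Z_{m,n}`, over the two-way variables
`Sum.inl i` (`i : Fin m`) and the one-way variables `Sum.inr j` (`j < n`):
`Z_{m,0} = x_1^♯ ⋯ x_m^♯` and `Z_{m,n} = Z_{m,n-1} y_n Z_{m,n-1}`. -/
def ZiminRev (m : ℕ) : ℕ → Set (List ((Fin m ⊕ ℕ) × Bool))
  | 0 => {p | ∃ b : Fin m → Bool, p = List.ofFn fun i => (Sum.inl i, b i)}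
  | n + 1 => {p | ∃ u ∈ ZiminRev m n, ∃ v ∈ ZiminRev m n,
      p = u ++ [(Sum.inr n, false)] ++ v}

/-- d-reversal: reverse a word over `Σ ∪ Σ^R` while swapping `x` with `x^R`. -/
def drev {V : Type*} (p : List (V × Bool)) : List (V × Bool) :=
  (p.map fun z => (z.1, !z.2)).reverse

/-- The image of a pattern with reversal under the d-reversal-respecting extension of `h`. -/
def applyDRev {V W : Type*} (h : V → List (W × Bool)) (p : List (V × Bool)) :
    List (W × Bool) :=
  p.flatMap fun z => if z.2 then drev (h z.1) else h z.1

/-- `φ` divides `ψ`: some non-erasing morphism respecting d-reversal sends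
every fragment of `φ` to a factor of a fragment of `ψ`. -/
def FDivides {V W : Type*} (φ : Set (List (V × Bool))) (ψ : Set (List (W × Bool))) : Prop :=
  ∃ h : V → List (W × Bool), NonErasing h ∧ ∀ p ∈ φ, ∃ q ∈ ψ, applyDRev h p <:+: q

/-- The letter `(x,b)` (i.e. `x` if `b = false`, `x^R` if `b = true`) appears in `φ`. -/
def Appears {V : Type*} (φ : Set (List (V × Bool))) (z : V × Bool) : Prop := ∃ p ∈ φ, z ∈ p

/-- `x` is a two-way variable of `φ`: both `x` and `x^R` appear in `φ`. -/
def TwoWay {V : Type*} (φ : Set (List (V × Bool))) (x : V) : Prop :=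
  Appears φ (x, false) ∧ Appears φ (x, true)

/-- `x` is a one-way variable of `φ`: exactly one of `x`, `x^R` appears in `φ`. -/
def OneWay {V : Type*} (φ : Set (List (V × Bool))) (x : V) : Prop :=
  (Appears φ (x, false) ∧ ¬ Appears φ (x, true)) ∨
  (Appears φ (x, true) ∧ ¬ Appears φ (x, false))

/-- The flattening of a pattern with reversal: forget all mirror images. -/
def flatten {V : Type*} (p : List (V × Bool)) : List V := p.map Prod.fst

/-- A finite word is a factor of an ω-word. -/
def InfFactor {A : Type*} (u : List A) (w : ℕ → A) : Prop :=
  ∃ i : ℕ, u = (List.range u.length).map fun j => w (i + j)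

/-- A formula with reversal occurs in an ω-word. -/
def OccursInInf {V A : Type*} (φ : Set (List (V × Bool))) (w : ℕ → A) : Prop :=
  ∃ h : V → List A, NonErasing h ∧ ∀ p ∈ φ, InfFactor (applyRev h p) w

/-- The image of a word (without reversal) under the extension of `h : Σ → A^*`. -/
def applyW {V A : Type*} (h : V → List A) (p : List V) : List A := p.flatMap h

/-- A formula without reversal occurs in a finite word. -/
def OccursInW {V A : Type*} (ψ : Set (List V)) (w : List A) : Prop :=
  ∃ h : V → List A, NonErasing h ∧ ∀ p ∈ ψ, applyW h p <:+: w

/-- A formula without reversal is avoidable. -/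
def WAvoidable {V : Type*} (ψ : Set (List V)) : Prop :=
  ∃ A : Type, Finite A ∧ {w : List A | ¬ OccursInW ψ w}.Infinite

section ZiminUnavoidable

variable {V W A : Type*}

lemma applyRev_append (h : V → List A) (p q : List (V × Bool)) :
    applyRev h (p ++ q) = applyRev h p ++ applyRev h q := by
  simp [applyRev]

lemma applyRev_cons (h : V → List A) (z : V × Bool) (p : List (V × Bool)) :
    applyRev h (z :: p) = (if z.2 then (h z.1).reverse else h z.1) ++ applyRev h p := by
  simp [applyRev]

lemma applyRev_ne_nil {h : V → List A} (hh : NonErasing h) {p : List (V × Bool)} (hp : p ≠ []) :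
    applyRev h p ≠ [] := by
  cases p with
  | nil => exact absurd rfl hp
  | cons z p =>
    rw [applyRev_cons]
    have := hh z.1
    split_ifs <;> simp [this]

lemma applyRev_drev (h : V → List A) (p : List (V × Bool)) :
    applyRev h (drev p) = (applyRev h p).reverse := by
  induction p with
  | nil => simp [applyRev, drev]
  | cons z p ih =>
    have hd : drev (z :: p) = drev p ++ [(z.1, !z.2)] := by simp [drev]
    rw [hd, applyRev_append, ih, applyRev_cons h z p, List.reverse_append]
    cases hz : z.2 <;> simp [applyRev]

lemma applyRev_applyDRev (g : W → List A) (h : V → List (W × Bool)) (p : List (V × Bool)) :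
    applyRev g (applyDRev h p) = applyRev (fun x => applyRev g (h x)) p := by
  induction p with
  | nil => simp [applyRev, applyDRev]
  | cons z p ih =>
    have hd : applyDRev h (z :: p) = (if z.2 then drev (h z.1) else h z.1) ++ applyDRev h p := by
      simp [applyDRev]
    rw [hd, applyRev_append, ih, applyRev_cons]
    split_ifs <;> simp [applyRev_drev]

lemma applyRev_congr {g g' : V → List A} {p : List (V × Bool)} (h : ∀ z ∈ p, g z.1 = g' z.1) :
    applyRev g p = applyRev g' p := by
  induction p with
  | nil => rfl
  | cons z p ih =>
    rw [applyRev_cons, applyRev_cons, h z (by simp), ih fun y hy => h y (by simp [hy])]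

lemma lt_of_inr_mem_ziminRev {m n : ℕ} {q : List ((Fin m ⊕ ℕ) × Bool)} (hq : q ∈ ZiminRev m n)
    {k : ℕ} {b : Bool} (hk : (Sum.inr k, b) ∈ q) : k < n := by
  induction n generalizing q with
  | zero =>
    obtain ⟨c, rfl⟩ := hq
    simp [List.mem_ofFn] at hk
  | succ n ih =>
    obtain ⟨u, hu, v, hv, rfl⟩ := hq
    simp only [List.mem_append, List.mem_singleton, Prod.mk.injEq, Sum.inr.injEq] at hk
    rcases hk with (hk | hk) | hk
    · exact (ih hu hk).trans n.lt_succ_self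
    · omega
    · exact (ih hv hk).trans n.lt_succ_self

/-- Two equal disjoint non-adjacent blocks of length `M` occur in every long enough word. -/
lemma exists_block_gap_block [Finite A] (M : ℕ) :
    ∃ M', ∀ w : List A, M' ≤ w.length →
      ∃ B c : List A, B.length = M ∧ c ≠ [] ∧ B ++ c ++ B <:+: w := by
  classical
  have : Finite {l : List A // l.length = M} := (List.finite_length_eq A M).to_subtype
  cases nonempty_fintype {l : List A // l.length = M}
  set f := Fintype.card {l : List A // l.length = M}
  refine ⟨(M + 1) * (f + 1), fun w hw => ?_⟩
  have hlen : ∀ j : Fin (f + 1), ((w.drop (j * (M + 1))).take M).length = M := by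
    intro j
    have : (j : ℕ) * (M + 1) + (M + 1) ≤ (M + 1) * (f + 1) := by
      nlinarith [j.isLt]
    simp only [List.length_take, List.length_drop]
    omega
  obtain ⟨i, j, hij, heq⟩ := Fintype.exists_ne_map_eq_of_card_lt
    (fun j : Fin (f + 1) => (⟨_, hlen j⟩ : {l : List A // l.length = M})) (by simp [f])
  wlog hlt : i < j generalizing i j
  · exact this j i hij.symm heq.symm (lt_of_le_of_ne (not_lt.mp hlt) hij.symm)
  have heq' : (w.drop (i * (M + 1))).take M = (w.drop (j * (M + 1))).take M :=
    congrArg Subtype.val heq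
  have hle : (i : ℕ) * (M + 1) + (M + 1) ≤ j * (M + 1) := by
    have : (i : ℕ) + 1 ≤ j := hlt
    nlinarith
  have hj : (j : ℕ) * (M + 1) + (M + 1) ≤ (M + 1) * (f + 1) := by
    nlinarith [j.isLt]
  refine ⟨(w.drop (i * (M + 1))).take M,
    (w.drop (i * (M + 1) + M)).take (j * (M + 1) - (i * (M + 1) + M)), hlen i, ?_, ?_⟩
  · apply List.ne_nil_of_length_pos
    simp only [List.length_take, List.length_drop]
    omega
  · refine ⟨w.take (i * (M + 1)), (w.drop (j * (M + 1))).drop M, ?_⟩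
    have h1 : w.drop (i * (M + 1)) =
        (w.drop (i * (M + 1))).take M ++ w.drop (i * (M + 1) + M) := by
      conv_lhs => rw [← List.take_append_drop M (w.drop (i * (M + 1)))]
      rw [List.drop_drop]
    have h2 : w.drop (i * (M + 1) + M) =
        (w.drop (i * (M + 1) + M)).take (j * (M + 1) - (i * (M + 1) + M)) ++
          w.drop (j * (M + 1)) := by
      conv_lhs => rw [← List.take_append_drop (j * (M + 1) - (i * (M + 1) + M))
        (w.drop (i * (M + 1) + M))]
      rw [List.drop_drop]
      congr 2
      omega
    conv_rhs => rw [← List.take_append_drop (i * (M + 1)) w, h1, h2,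
      ← List.take_append_drop M (w.drop (j * (M + 1)))]
    rw [← heq']
    simp only [List.append_assoc]

/-- Every long enough word contains a common image of all fragments of `Z_{m,n}`. -/
lemma exists_ziminRev_image_infix [Finite A] (m n : ℕ) :
    ∃ M, ∀ w : List A, M ≤ w.length → ∃ g : Fin m ⊕ ℕ → List A, NonErasing g ∧
      ∃ U, U <:+: w ∧ ∀ q ∈ ZiminRev m n, applyRev g q = U := by
  induction n with
  | zero =>
    refine ⟨m + 1, fun w hw => ?_⟩
    refine ⟨Sum.elim (fun i => [w[(i : ℕ)]]) (fun _ => [w[0]]), ?_, w.take m,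
      (List.take_prefix m w).isInfix, ?_⟩
    · rintro (i | j) <;> simp
    · rintro q ⟨b, rfl⟩
      have hflat : ∀ l : List (Fin m), applyRev (Sum.elim (fun i : Fin m => [w[(i : ℕ)]])
          (fun _ : ℕ => [w[0]])) (l.map fun i => (Sum.inl i, b i)) =
            l.map fun i : Fin m => w[(i : ℕ)] := by
        intro l
        induction l with
        | nil => rfl
        | cons i l ih => rw [List.map_cons, applyRev_cons, ih]; cases h : b i <;> simp
      rw [List.ofFn_eq_map, hflat]
      apply List.ext_getElem <;> simp
      omega
  | succ n ih =>
    obtain ⟨M, hM⟩ := ih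
    obtain ⟨M', hM'⟩ := exists_block_gap_block (A := A) M
    refine ⟨M', fun w hw => ?_⟩
    obtain ⟨B, c, hB, hc, hw⟩ := hM' w hw
    obtain ⟨g, hg, U, ⟨a, b, hU⟩, hgU⟩ := hM B hB.ge
    have hsame : ∀ q ∈ ZiminRev m n,
        applyRev (Function.update g (Sum.inr n) (b ++ c ++ a)) q = U := by
      intro q hq
      rw [← hgU q hq]
      refine applyRev_congr fun z hz => ?_
      obtain ⟨x, s⟩ := z
      refine Function.update_of_ne ?_ _ _
      rintro rfl
      exact absurd (lt_of_inr_mem_ziminRev hq hz) (lt_irrefl _)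
    refine ⟨Function.update g (Sum.inr n) (b ++ c ++ a), fun x => ?_,
      U ++ (b ++ c ++ a) ++ U, List.IsInfix.trans ⟨a, b, ?_⟩ hw, ?_⟩
    · by_cases hx : x = Sum.inr n
      · subst hx; simp [hc]
      · rw [Function.update_of_ne hx]; exact hg x
    · rw [← hU]; simp only [List.append_assoc]
    · rintro q ⟨u, hu, v, hv, rfl⟩
      rw [applyRev_append, applyRev_append, hsame u hu, hsame v hv]
      simp [applyRev]

lemma not_fAvoidable_of_fDivides {φ : Set (List (V × Bool))} {m n : ℕ}
    (hdiv : FDivides φ (ZiminRev m n)) : ¬ FAvoidable φ := by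
  rintro ⟨A, hA, hinf⟩
  obtain ⟨h, hh, hφ⟩ := hdiv
  obtain ⟨M, hM⟩ := exists_ziminRev_image_infix (A := A) m n
  refine hinf ((List.finite_length_lt A M).subset fun w hw => ?_)
  by_contra hlen
  obtain ⟨g, hg, U, hU, hgU⟩ := hM w (not_lt.mp hlen)
  refine hw ⟨fun x => applyRev g (h x), fun x => applyRev_ne_nil hg (hh x), fun p hp => ?_⟩
  obtain ⟨q, hq, a, b, hab⟩ := hφ p hp
  rw [← applyRev_applyDRev]
  refine List.IsInfix.trans ⟨applyRev g a, applyRev g b, ?_⟩ hU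
  rw [← applyRev_append, ← applyRev_append, hab, hgU q hq]

end ZiminUnavoidable

section SesquipowerFree

variable {α : Type*}

/-- `s` has no factor `u v u` with `u` nonempty and `|v| ≤ |u|`; here `ℓ = |u|` and
`t = |u v|`. -/
def SesquipowerFree (s : List α) : Prop :=
  ∀ i t ℓ, 0 < ℓ → ℓ ≤ t → t ≤ 2 * ℓ → i + t + ℓ ≤ s.length →
    (s.drop i).take ℓ ≠ (s.drop (i + t)).take ℓ

lemma SesquipowerFree.drop {s : List α} (hs : SesquipowerFree s) (k : ℕ) :
    SesquipowerFree (s.drop k) := by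
  intro i t ℓ h0 h1 h2 h3
  rw [List.length_drop] at h3
  rw [List.drop_drop, List.drop_drop, ← add_assoc]
  exact hs (k + i) t ℓ h0 h1 h2 (by omega)

lemma exists_prefix_of_not_sesquipowerFree_cons {x : α} {s : List α} (hs : SesquipowerFree s)
    (hx : ¬ SesquipowerFree (x :: s)) :
    ∃ t ℓ, 0 < ℓ ∧ ℓ ≤ t ∧ t ≤ 2 * ℓ ∧ t + ℓ ≤ s.length + 1 ∧
      (x :: s).take ℓ = ((x :: s).drop t).take ℓ := by
  unfold SesquipowerFree at hx
  push Not at hx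
  obtain ⟨i, t, ℓ, h0, h1, h2, h3, h4⟩ := hx
  cases i with
  | zero => exact ⟨t, ℓ, h0, h1, h2, by simpa using h3, by simpa using h4⟩
  | succ i =>
    rw [List.length_cons] at h3
    rw [show i + 1 + t = (i + t) + 1 by omega, List.drop_succ_cons, List.drop_succ_cons] at h4
    exact absurd h4 (hs i t ℓ h0 h1 h2 (by omega))

open Classical in
/-- The words of length `n` over eight letters that are `SesquipowerFree`. -/
noncomputable def sesquipowerFreeWords : ℕ → Finset (List (Fin 8))
  | 0 => {[]}
  | n + 1 => ((Finset.univ ×ˢ sesquipowerFreeWords n).image fun z => z.1 :: z.2).filter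
      SesquipowerFree

lemma mem_sesquipowerFreeWords {n : ℕ} {s : List (Fin 8)} :
    s ∈ sesquipowerFreeWords n ↔ s.length = n ∧ SesquipowerFree s := by
  induction n generalizing s with
  | zero =>
    simp only [sesquipowerFreeWords, Finset.mem_singleton, List.length_eq_zero_iff]
    refine ⟨?_, fun h => h.1⟩
    rintro rfl
    refine ⟨rfl, fun i t ℓ h0 _ _ h3 => ?_⟩
    simp only [List.length_nil] at h3
    omega
  | succ n ih =>
    simp only [sesquipowerFreeWords, Finset.mem_filter, Finset.mem_image, Finset.mem_product,
      Finset.mem_univ, true_and, Prod.exists]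
    constructor
    · rintro ⟨⟨x, s, hs, rfl⟩, hf⟩
      exact ⟨by simp [(ih.mp hs).1], hf⟩
    · rintro ⟨hl, hf⟩
      refine ⟨?_, hf⟩
      cases s with
      | nil => simp at hl
      | cons x s => exact ⟨x, s, ih.mpr ⟨by simpa using hl, by simpa using hf.drop 1⟩, rfl⟩

lemma card_extensions_le (n : ℕ) :
    8 * (sesquipowerFreeWords n).card ≤ (sesquipowerFreeWords (n + 1)).card +
      ∑ j ∈ Finset.range (n + 1), (n + 2 - j) * (sesquipowerFreeWords j).card := by
  classical
  set E := (Finset.univ ×ˢ sesquipowerFreeWords n).image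
    (fun z : Fin 8 × List (Fin 8) => z.1 :: z.2) with hE
  have hcard : E.card = 8 * (sesquipowerFreeWords n).card := by
    rw [hE, Finset.card_image_of_injective, Finset.card_product]
    · simp
    · rintro ⟨a, b⟩ ⟨c, d⟩ h
      simpa using h
  have hbad : E.filter (fun s => ¬ SesquipowerFree s) ⊆
      (Finset.range (n + 1)).biUnion fun j => (Finset.range (n + 2 - j)).biUnion fun k =>
        (sesquipowerFreeWords j).image fun s => (s.drop k).take (n + 1 - j) ++ s := by
    intro w hw
    simp only [hE, Finset.mem_filter, Finset.mem_image, Finset.mem_product, Finset.mem_univ,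
      true_and, Prod.exists] at hw
    obtain ⟨⟨x, s, hs, rfl⟩, hx⟩ := hw
    rw [mem_sesquipowerFreeWords] at hs
    obtain ⟨t, ℓ, h0, h1, h2, h3, h4⟩ := exists_prefix_of_not_sesquipowerFree_cons hs.2 hx
    simp only [Finset.mem_biUnion, Finset.mem_range, Finset.mem_image]
    refine ⟨n + 1 - ℓ, by omega, t - ℓ, by omega, (x :: s).drop ℓ, ?_, ?_⟩
    · rw [mem_sesquipowerFreeWords]
      refine ⟨by simp [hs.1], ?_⟩
      obtain ⟨e, rfl⟩ : ∃ e, ℓ = e + 1 := ⟨ℓ - 1, by omega⟩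
      rw [List.drop_succ_cons]
      exact hs.2.drop e
    · rw [List.drop_drop, show ℓ + (t - ℓ) = t by omega,
        show n + 1 - (n + 1 - ℓ) = ℓ by omega, ← h4, List.take_append_drop]
  have hle : (E.filter (fun s => ¬ SesquipowerFree s)).card ≤
      ∑ j ∈ Finset.range (n + 1), (n + 2 - j) * (sesquipowerFreeWords j).card := by
    refine (Finset.card_le_card hbad).trans (Finset.card_biUnion_le.trans ?_)
    refine Finset.sum_le_sum fun j _ => Finset.card_biUnion_le.trans ?_
    refine (Finset.sum_le_sum fun k _ => Finset.card_image_le).trans ?_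
    simp
  have hsplit := Finset.card_filter_add_card_filter_not (s := E) SesquipowerFree
  have hgood : E.filter SesquipowerFree = sesquipowerFreeWords (n + 1) := rfl
  rw [hgood] at hsplit
  omega

/-- If `a` at least doubles up to `n`, the weighted sum of its values is at most `6 * a n`. -/
lemma sum_weighted_le (a : ℕ → ℕ) (n : ℕ) (ha : ∀ j < n, 2 * a j ≤ a (j + 1)) :
    ∑ j ∈ Finset.range (n + 1), a j ≤ 2 * a n ∧
      ∑ j ∈ Finset.range (n + 1), (n + 2 - j) * a j ≤ 6 * a n := by
  induction n with
  | zero => simp; omega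
  | succ n ih =>
    obtain ⟨h1, h2⟩ := ih fun j hj => ha j (by omega)
    have h3 := ha n (by omega)
    have h4 : ∑ j ∈ Finset.range (n + 1), (n + 1 + 2 - j) * a j =
        ∑ j ∈ Finset.range (n + 1), (n + 2 - j) * a j + ∑ j ∈ Finset.range (n + 1), a j := by
      rw [← Finset.sum_add_distrib]
      refine Finset.sum_congr rfl fun j hj => ?_
      rw [Finset.mem_range] at hj
      rw [show n + 1 + 2 - j = (n + 2 - j) + 1 by omega]
      ring
    rw [Finset.sum_range_succ, Finset.sum_range_succ _ (n + 1), h4,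
      show n + 1 + 2 - (n + 1) = 2 by omega]
    omega

lemma two_mul_card_sesquipowerFreeWords_le (n : ℕ) :
    2 * (sesquipowerFreeWords n).card ≤ (sesquipowerFreeWords (n + 1)).card := by
  induction n using Nat.strong_induction_on with
  | _ n ih =>
    have h1 := card_extensions_le n
    have h2 := (sum_weighted_le (fun j => (sesquipowerFreeWords j).card) n ih).2
    omega

lemma exists_sesquipowerFree (n : ℕ) :
    ∃ s : List (Fin 8), s.length = n ∧ SesquipowerFree s := by
  have hpos : 0 < (sesquipowerFreeWords n).card := by
    induction n with
    | zero => simp [sesquipowerFreeWords]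
    | succ n ih => have := two_mul_card_sesquipowerFreeWords_le n; omega
  obtain ⟨s, hs⟩ := Finset.card_pos.mp hpos
  exact ⟨s, mem_sesquipowerFreeWords.mp hs⟩

/-- Long enough sequences without repetitions of exponent at least `3 / 2`. -/
lemma exists_seq_no_sesquipower (N : ℕ) :
    ∃ s : ℕ → Fin 8, ∀ i t ℓ, 0 < t → 0 < ℓ → t ≤ 2 * ℓ → i + t + ℓ ≤ N →
      ∃ j < ℓ, s (i + j) ≠ s (i + t + j) := by
  obtain ⟨s, hl, hs⟩ := exists_sesquipowerFree N
  refine ⟨fun i => s.getD i 0, fun i t ℓ ht hℓ htℓ hN => ?_⟩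
  by_contra! hcon
  refine hs i t (min ℓ t) (by omega) (by omega) (by omega) (by omega) ?_
  apply List.ext_getElem
  · simp only [List.length_take, List.length_drop]; omega
  · intro j h1 h2
    simp only [List.length_take, List.length_drop] at h1 h2
    have := hcon j (by omega)
    rw [List.getD_eq_getElem _ _ (by omega), List.getD_eq_getElem _ _ (by omega)] at this
    simpa using this

end SesquipowerFree

section BlockWord

/-- The word `i ↦ (i mod K, s_{⌊i / K⌋})`. -/
def blockWord {α : Type*} (K : ℕ) (hK : 0 < K) (s : ℕ → α) (i : ℕ) : Fin K × α :=
  (⟨i % K, Nat.mod_lt i hK⟩, s (i / K))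

lemma mod_eq_of_blockWord_eq {α : Type*} {K : ℕ} {hK : 0 < K} {s : ℕ → α} {i j : ℕ}
    (h : blockWord K hK s i = blockWord K hK s j) : i % K = j % K := by
  simpa [blockWord] using congrArg (fun z => (z.1 : ℕ)) h

/-- A repetition with period `P` and excess `ℓ` in the block word of a sequence without
repetitions of exponent at least `3 / 2` has exponent well below `3 / 2`. -/
lemma period_gt_of_blockWord_repeat {α : Type*} {K : ℕ} {hK : 0 < K} {s : ℕ → α} {N C : ℕ}
    (hC : 2 * C < K)
    (hs : ∀ i t ℓ, 0 < t → 0 < ℓ → t ≤ 2 * ℓ → i + t + ℓ ≤ N →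
      ∃ j < ℓ, s (i + j) ≠ s (i + t + j))
    {i P ℓ : ℕ} (hP : 0 < P) (hℓ : 0 < ℓ) (hN : i + P + ℓ ≤ N * K)
    (hrep : ∀ j < ℓ, blockWord K hK s (i + j) = blockWord K hK s (i + P + j)) :
    2 * ℓ + 2 * C < P := by
  by_contra! hle
  have hdvd : K ∣ P := by
    have h0 := mod_eq_of_blockWord_eq (hrep 0 hℓ)
    have h1 : i + 0 ≡ i + P [MOD K] := h0
    exact (Nat.modEq_zero_iff_dvd.mp (Nat.ModEq.add_left_cancel' i h1).symm)
  obtain ⟨t, rfl⟩ := hdvd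
  have ht : 0 < t := Nat.pos_of_mul_pos_left hP
  -- the excess meets the `n` blocks numbered from `i / K`
  set n := (i + ℓ - 1) / K - i / K + 1 with hn
  have hdiv : i / K ≤ (i + ℓ - 1) / K := Nat.div_le_div_right (by omega)
  have hlast : i / K + n = (i + ℓ - 1) / K + 1 := by omega
  have hcover : ℓ ≤ n * K := by
    have h1 := Nat.div_add_mod i K
    have h2 := Nat.div_add_mod (i + ℓ - 1) K
    have h3 := Nat.mod_lt (i + ℓ - 1) hK
    have h4 : K * (i / K) + K * n = K * ((i + ℓ - 1) / K) + K := by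
      rw [← mul_add, hlast, mul_add, mul_one]
    rw [mul_comm n K]
    omega
  have htn : t ≤ 2 * n := by
    by_contra! hlt
    have : K * (2 * n + 1) ≤ K * t := Nat.mul_le_mul_left K hlt
    nlinarith
  obtain ⟨j, hj, hne⟩ := hs (i / K) t n ht (by omega) htn (by
    have h1 : (i + K * t + ℓ - 1) / K = (i + ℓ - 1) / K + t := by
      rw [show i + K * t + ℓ - 1 = (i + ℓ - 1) + K * t by omega, Nat.add_mul_div_left _ _ hK]
    have h2 : (i + K * t + ℓ - 1) / K < N := by
      rw [Nat.div_lt_iff_lt_mul hK]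
      omega
    omega)
  -- a position of the excess in block `i / K + j`
  obtain ⟨d, hd, hblock⟩ : ∃ d < ℓ, (i + d) / K = i / K + j := by
    by_cases hj0 : j = 0
    · exact ⟨0, hℓ, by simp [hj0]⟩
    · have h1 : i ≤ (i / K + j) * K := by
        have := Nat.lt_div_mul_add (a := i) hK
        have : K ≤ j * K := Nat.le_mul_of_pos_left K (by omega)
        nlinarith
      have h2 : (i / K + j) * K ≤ i + ℓ - 1 :=
        (Nat.mul_le_mul_right K (by omega)).trans (Nat.div_mul_le_self (i + ℓ - 1) K)
      refine ⟨(i / K + j) * K - i, by omega, ?_⟩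
      rw [show i + ((i / K + j) * K - i) = (i / K + j) * K by omega, Nat.mul_div_cancel _ hK]
  have heq := congrArg Prod.snd (hrep d hd)
  simp only [blockWord] at heq
  rw [show i + K * t + d = (i + d) + K * t by ring, Nat.add_mul_div_left _ _ hK, hblock] at heq
  refine hne ?_
  rw [heq]
  congr 1
  omega

/-- The finite word `u` stands at position `i` of `W`. -/
def OccursAt {A : Type*} (W : ℕ → A) (u : List A) (i : ℕ) : Prop :=
  ∀ j (hj : j < u.length), u[j] = W (i + j)

lemma OccursAt.of_append {A : Type*} {W : ℕ → A} {u v : List A} {i : ℕ}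
    (h : OccursAt W (u ++ v) i) : OccursAt W u i ∧ OccursAt W v (i + u.length) := by
  constructor
  · intro j hj
    have := h j (by simp; omega)
    rwa [List.getElem_append_left hj] at this
  · intro j hj
    have := h (u.length + j) (by simp; omega)
    rw [List.getElem_append_right (by omega)] at this
    simpa [add_assoc] using this

lemma exists_occursAt_of_infix {A : Type*} {W : ℕ → A} {u : List A} {N : ℕ}
    (h : u <:+: (List.range N).map W) : ∃ i, i + u.length ≤ N ∧ OccursAt W u i := by
  obtain ⟨a, b, hab⟩ := h
  have hlen := congrArg List.length hab
  simp only [List.length_append, List.length_map, List.length_range] at hlen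
  have hall : OccursAt W (a ++ u ++ b) 0 := by
    intro j hj
    simp only [hab]
    simp
  refine ⟨a.length, by omega, ?_⟩
  simpa using hall.of_append.1.of_append.2

end BlockWord

section Division

open Classical

variable {V : Type*} {φ : Set (List (V × Bool))}

lemma appears_of_mem {p : List (V × Bool)} (hp : p ∈ φ) {z : V × Bool} (hz : z ∈ p) :
    Appears φ z := ⟨p, hp, hz⟩

lemma oneWay_of_appears {z : V × Bool} (hz : Appears φ z) (h : ¬ TwoWay φ z.1) :
    OneWay φ z.1 := by
  obtain ⟨x, _ | _⟩ := z
  · exact Or.inl ⟨hz, fun h' => h ⟨hz, h'⟩⟩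
  · exact Or.inr ⟨hz, fun h' => h ⟨h', hz⟩⟩

lemma eq_of_appears_of_not_twoWay {z z' : V × Bool} (hz : Appears φ z) (hz' : Appears φ z')
    (h : ¬ TwoWay φ z.1) (heq : z.1 = z'.1) : z = z' := by
  obtain ⟨x, b⟩ := z
  obtain ⟨x', b'⟩ := z'
  obtain rfl : x = x' := heq
  cases b <;> cases b'
  · rfl
  · exact absurd ⟨hz, hz'⟩ h
  · exact absurd ⟨hz', hz⟩ h
  · rfl

/-- The image of a single letter under the reversal-respecting extension of `h`. -/
def letterImage {A : Type*} (h : V → List A) (z : V × Bool) : List A :=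
  if z.2 then (h z.1).reverse else h z.1

lemma applyRev_cons_letterImage {A : Type*} (h : V → List A) (z : V × Bool)
    (p : List (V × Bool)) : applyRev h (z :: p) = letterImage h z ++ applyRev h p :=
  applyRev_cons h z p

lemma length_letterImage {A : Type*} (h : V → List A) (z : V × Bool) :
    (letterImage h z).length = (h z.1).length := by
  unfold letterImage; split_ifs <;> simp

lemma length_applyRev_of_length_one {A : Type*} {h : V → List A} {u : List (V × Bool)}
    (hu : ∀ z ∈ u, (h z.1).length = 1) : (applyRev h u).length = u.length := by
  induction u with
  | nil => rfl
  | cons z u ih =>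
    rw [applyRev_cons_letterImage, List.length_append, length_letterImage, hu z (by simp),
      ih fun y hy => hu y (by simp [hy]), List.length_cons, add_comm]

lemma exists_occursAt_letterImage {A : Type*} {W : ℕ → A} {h : V → List A}
    (hocc : ∀ p ∈ φ, ∃ i, OccursAt W (applyRev h p) i) {z : V × Bool} (hz : Appears φ z) :
    ∃ i, OccursAt W (letterImage h z) i := by
  obtain ⟨p, hp, hzp⟩ := hz
  obtain ⟨a, b, rfl⟩ := List.append_of_mem hzp
  obtain ⟨i, hi⟩ := hocc _ hp
  rw [applyRev_append, applyRev_cons_letterImage] at hi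
  exact ⟨_, hi.of_append.2.of_append.1⟩

lemma length_eq_one_of_twoWay {α : Type*} {K : ℕ} {hK : 0 < K} (hK3 : 3 ≤ K) {s : ℕ → α}
    {h : V → List (Fin K × α)} (hne : NonErasing h)
    (hocc : ∀ p ∈ φ, ∃ i, OccursAt (blockWord K hK s) (applyRev h p) i) {x : V}
    (hx : TwoWay φ x) : (h x).length = 1 := by
  obtain ⟨i, hi⟩ := exists_occursAt_letterImage hocc hx.1
  obtain ⟨i', hi'⟩ := exists_occursAt_letterImage hocc hx.2
  simp only [letterImage, Bool.false_eq_true, if_false, if_true] at hi hi'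
  have hpos := List.length_pos_iff.mpr (hne x)
  by_contra hlen
  have e0 := hi 0 (by omega)
  have e1 := hi 1 (by omega)
  have f0 := hi' ((h x).length - 1) (by simp; omega)
  have f1 := hi' ((h x).length - 2) (by simp; omega)
  rw [List.getElem_reverse] at f0 f1
  simp only [show (h x).length - 1 - ((h x).length - 1) = 0 by omega,
    show (h x).length - 1 - ((h x).length - 2) = 1 by omega] at f0 f1
  have m0 : i + 0 ≡ i' + ((h x).length - 1) [MOD K] := mod_eq_of_blockWord_eq (e0.symm.trans f0)
  have m1 : i + 1 ≡ i' + ((h x).length - 2) [MOD K] := mod_eq_of_blockWord_eq (e1.symm.trans f1)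
  have m2 : i + 2 ≡ i + 0 [MOD K] := by
    have := m1.add_right 1
    rw [show i' + ((h x).length - 2) + 1 = i' + ((h x).length - 1) by omega] at this
    exact this.trans m0.symm
  have m3 := (Nat.modEq_zero_iff_dvd.mp (Nat.ModEq.add_left_cancel' i m2))
  exact absurd (Nat.le_of_dvd (by norm_num) m3) (by omega)

/-- All occurrences of the image of a variable start at the same residue modulo `K`. -/
lemma exists_start_residue {α : Type*} {K : ℕ} {hK : 0 < K} {s : ℕ → α}
    {h : V → List (Fin K × α)} (hne : NonErasing h)
    (hlen : ∀ x, TwoWay φ x → (h x).length = 1) :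
    ∃ L : V → ℕ, ∀ z, Appears φ z → ∀ i, OccursAt (blockWord K hK s) (letterImage h z) i →
      i % K = L z.1 := by
  have key : ∀ x, ∃ r, ∀ b, Appears φ (x, b) → ∀ i,
      OccursAt (blockWord K hK s) (letterImage h (x, b)) i → i % K = r := by
    intro x
    by_cases hex : ∃ b i, Appears φ (x, b) ∧ OccursAt (blockWord K hK s) (letterImage h (x, b)) i
    · obtain ⟨b, i, hb, hi⟩ := hex
      refine ⟨i % K, fun b' hb' i' hi' => ?_⟩
      have hsame : letterImage h (x, b') = letterImage h (x, b) := by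
        by_cases hx : TwoWay φ x
        · obtain ⟨c, hc⟩ := List.length_eq_one_iff.mp (hlen x hx)
          simp [letterImage, hc]
        · rw [eq_of_appears_of_not_twoWay hb' hb hx rfl]
      rw [hsame] at hi'
      have hpos : 0 < (letterImage h (x, b)).length := by
        rw [length_letterImage]; exact List.length_pos_iff.mpr (hne x)
      exact mod_eq_of_blockWord_eq ((hi' 0 hpos).symm.trans (hi 0 hpos))
    · exact ⟨0, fun b hb i hi => absurd ⟨b, i, hb, hi⟩ hex⟩
  choose L hL using key
  exact ⟨L, fun z => hL z.1 z.2⟩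

/-- A set `E` of `m < K` residues modulo `K`, viewed as edges `e → e + 1` of a cycle, can be
contracted onto a path with `m` edges. -/
lemma exists_level {K m : ℕ} (E : Finset ℕ) (hE : E.card ≤ m) (hmK : m < K) :
    ∃ lev : ℕ → ℕ, (∀ i j, i % K = j % K → lev i = lev j) ∧ (∀ i, lev i ≤ m) ∧
      ∀ i, i % K ∈ E → lev (i + 1) = lev i + 1 := by
  obtain ⟨ρ, hρK, hρE⟩ : ∃ ρ ∈ Finset.range K, ρ ∉ E :=
    Finset.exists_mem_notMem_of_card_lt_card (by simp; omega)
  rw [Finset.mem_range] at hρK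
  set c := K - 1 - ρ with hc
  refine ⟨fun i => (E.filter fun e => e < K ∧ (e + c) % K < (i + c) % K).card, ?_, ?_, ?_⟩
  · intro i j hij
    have : (i + c) % K = (j + c) % K := Nat.ModEq.add_right c hij
    simp only [this]
  · exact fun i => (Finset.card_filter_le _ _).trans hE
  · intro i hi
    have hcancel : ∀ e < K, (e + c) % K = (i + c) % K → e = i % K := by
      intro e he heq
      have h1 : e ≡ i [MOD K] := Nat.ModEq.add_right_cancel' c heq
      rw [← Nat.mod_eq_of_lt he]
      exact h1
    have hmod : (i % K + c) % K = (i + c) % K := by simp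
    have hlt : (i + c) % K + 1 < K := by
      have h1 := Nat.mod_lt (i + c) (by omega : 0 < K)
      by_contra hge
      refine hρE ?_
      rw [hcancel ρ hρK ?_]
      · exact hi
      · rw [show ρ + c = K - 1 by omega, Nat.mod_eq_of_lt (by omega)]
        omega
    have hsucc : (i + 1 + c) % K = (i + c) % K + 1 := by
      rw [show i + 1 + c = (i + c) + 1 by ring, Nat.add_mod,
        Nat.mod_eq_of_lt (by omega : 1 < K), Nat.mod_eq_of_lt hlt]
    have hins : (E.filter fun e => e < K ∧ (e + c) % K < (i + 1 + c) % K) =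
        insert (i % K) (E.filter fun e => e < K ∧ (e + c) % K < (i + c) % K) := by
      ext e
      simp only [Finset.mem_filter, Finset.mem_insert, hsucc]
      constructor
      · rintro ⟨h1, h2, h3⟩
        rcases Nat.lt_succ_iff_lt_or_eq.mp h3 with h | h
        · exact Or.inr ⟨h1, h2, h⟩
        · exact Or.inl (hcancel e h2 h)
      · rintro (rfl | ⟨h1, h2, h3⟩)
        · exact ⟨hi, Nat.mod_lt _ (by omega), by omega⟩
        · exact ⟨h1, h2, by omega⟩
    simp only [hins]
    rw [Finset.card_insert_of_notMem]
    simp [hmod]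

/-- The word `x_1 ⋯ x_m` of two-way variables of `Z_{m,n}`. -/
def twoWayRow (m : ℕ) : List (Fin m ⊕ ℕ) := (List.finRange m).map Sum.inl

/-- The word `X y_{j_1} X y_{j_2} ⋯ y_{j_k} X` with `X = x_1 ⋯ x_m`. -/
def interleave (m : ℕ) (σ : List ℕ) : List (Fin m ⊕ ℕ) :=
  twoWayRow m ++ σ.flatMap fun j => Sum.inr j :: twoWayRow m

/-- The indices of the one-way variables along any fragment of `Z_{m,n}`. -/
def ziminIndices : ℕ → List ℕ
  | 0 => []
  | n + 1 => ziminIndices n ++ [n] ++ ziminIndices n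

lemma interleave_append_cons (m : ℕ) (σ τ : List ℕ) (j : ℕ) :
    interleave m (σ ++ j :: τ) = interleave m σ ++ Sum.inr j :: interleave m τ := by
  simp [interleave]

lemma interleave_infix {m : ℕ} {σ τ : List ℕ} (h : σ <:+: τ) :
    interleave m σ <:+: interleave m τ := by
  obtain ⟨a, b, rfl⟩ := h
  have h1 : interleave m (a ++ σ) <:+: interleave m (a ++ σ ++ b) :=
    ⟨[], b.flatMap fun j => Sum.inr j :: twoWayRow m, by simp [interleave]⟩
  refine List.IsInfix.trans ?_ h1
  induction a with
  | nil => exact List.infix_refl _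
  | cons j a ih =>
    refine (ih ⟨[], b.flatMap fun j => Sum.inr j :: twoWayRow m, by simp [interleave]⟩).trans
      ⟨twoWayRow m ++ [Sum.inr j], [], ?_⟩
    simp [interleave]

lemma mem_ziminRev_of_map_fst {m n : ℕ} {q : List ((Fin m ⊕ ℕ) × Bool)}
    (hq : q.map Prod.fst = interleave m (ziminIndices n))
    (hs : ∀ j b, (Sum.inr j, b) ∈ q → b = false) : q ∈ ZiminRev m n := by
  induction n generalizing q with
  | zero =>
    simp only [ziminIndices, interleave, List.flatMap_nil, List.append_nil, twoWayRow] at hq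
    have hlen : q.length = m := by simpa using congrArg List.length hq
    refine ⟨fun i => (q[(i : ℕ)]).2, List.ext_getElem (by simp [hlen]) fun i h1 h2 => ?_⟩
    have h3 : (q.map Prod.fst)[i]'(by simpa using h1) =
      ((List.finRange m).map Sum.inl)[i]'(by simpa [hlen] using h1) := by simp only [hq]
    simp only [List.getElem_map, List.getElem_finRange] at h3
    ext1
    · simpa using h3
    · simp
  | succ n ih =>
    rw [ziminIndices, List.append_assoc, List.singleton_append, interleave_append_cons,
      List.map_eq_append_iff] at hq
    obtain ⟨u, r, rfl, hu, hr⟩ := hq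
    rw [List.map_eq_cons_iff] at hr
    obtain ⟨⟨x, b⟩, v, rfl, hx, hv⟩ := hr
    obtain rfl : x = Sum.inr n := hx
    obtain rfl := hs n b (by simp)
    exact ⟨u, ih hu fun j b h => hs j b (by simp [h]), v, ih hv fun j b h => hs j b (by simp [h]),
      by simp⟩

lemma exists_mem_ziminRev_of_infix {m n : ℕ} {u : List ((Fin m ⊕ ℕ) × Bool)}
    (hu : u.map Prod.fst <:+: interleave m (ziminIndices n))
    (hs : ∀ j b, (Sum.inr j, b) ∈ u → b = false) : ∃ q ∈ ZiminRev m n, u <:+: q := by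
  obtain ⟨a, b, hab⟩ := hu
  refine ⟨a.map (·, false) ++ u ++ b.map (·, false), mem_ziminRev_of_map_fst ?_ ?_, _, _, rfl⟩
  · simp only [List.map_append, List.map_map, Function.comp_def, List.map_id', hab]
  · intro j c h
    simp only [List.mem_append, List.mem_map, Prod.mk.injEq] at h
    rcases h with (⟨_, _, _, h⟩ | h) | ⟨_, _, _, h⟩
    · exact h.symm
    · exact hs j c h
    · exact h.symm

lemma drev_drev (p : List (V × Bool)) : drev (drev p) = p := by
  simp [drev, Function.comp_def]

/-- The indices, under `idx`, of the variables along `p` that are not two-way in `φ`. -/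
noncomputable def oneWayIndices (φ : Set (List (V × Bool))) (idx : V → ℕ)
    (p : List (V × Bool)) : List ℕ :=
  p.filterMap fun z => if TwoWay φ z.1 then none else some (idx z.1)

/-- The image of a variable `x` that starts at level `a x` and ends at level `b x`, without
mirror marks. -/
noncomputable def levelImage (φ : Set (List (V × Bool))) (m : ℕ) (idx a b : V → ℕ) (x : V) :
    List (Fin m ⊕ ℕ) :=
  if TwoWay φ x then ((twoWayRow m).drop (a x)).take 1
  else (twoWayRow m).drop (a x) ++ Sum.inr (idx x) :: (twoWayRow m).take (b x)

/-- A morphism whose letter images are, up to mirror marks, given by `levelImage`. -/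
noncomputable def levelMorphism (φ : Set (List (V × Bool))) (m : ℕ) (idx a b : V → ℕ) (x : V) :
    List ((Fin m ⊕ ℕ) × Bool) :=
  if TwoWay φ x ∨ ¬ Appears φ (x, true) then (levelImage φ m idx a b x).map (·, false)
  else drev ((levelImage φ m idx a b x).map (·, false))

lemma inr_notMem_twoWayRow (m j : ℕ) : Sum.inr j ∉ twoWayRow m := by
  simp [twoWayRow]

lemma levelMorphism_letter {m : ℕ} {idx a b : V → ℕ} {z : V × Bool} (hz : Appears φ z) :
    ((if z.2 then drev (levelMorphism φ m idx a b z.1) else levelMorphism φ m idx a b z.1).map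
        Prod.fst = levelImage φ m idx a b z.1) ∧
      ∀ j c, (Sum.inr j, c) ∈ (if z.2 then drev (levelMorphism φ m idx a b z.1)
        else levelMorphism φ m idx a b z.1) → c = false := by
  obtain ⟨x, s⟩ := z
  have hmap : ((levelImage φ m idx a b x).map (·, false)).map Prod.fst =
      levelImage φ m idx a b x := by simp [Function.comp_def]
  have hfalse : ∀ j c, (Sum.inr j, c) ∈ (levelImage φ m idx a b x).map (·, false) →
      c = false := by
    intro j c h
    simp only [List.mem_map, Prod.mk.injEq] at h
    obtain ⟨_, _, _, h⟩ := h
    exact h.symm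
  cases s with
  | false =>
    have hH : levelMorphism φ m idx a b x = (levelImage φ m idx a b x).map (·, false) :=
      if_pos (by by_cases h : Appears φ (x, true); exacts [Or.inl ⟨hz, h⟩, Or.inr h])
    simp [hH, Function.comp_def]
  | true =>
    by_cases hx : TwoWay φ x
    · have hH : levelMorphism φ m idx a b x = (levelImage φ m idx a b x).map (·, false) :=
        if_pos (Or.inl hx)
      have hI : levelImage φ m idx a b x = ((twoWayRow m).drop (a x)).take 1 := if_pos hx
      have hrev : (((twoWayRow m).drop (a x)).take 1).reverse =
          ((twoWayRow m).drop (a x)).take 1 := by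
        rcases (twoWayRow m).drop (a x) with _ | ⟨y, l⟩ <;> simp
      simp only [if_true, hH, hI, drev]
      constructor
      · rw [List.map_reverse, List.map_map, List.map_map]
        simpa [Function.comp_def] using hrev
      · intro j c h
        simp only [List.mem_reverse, List.mem_map] at h
        obtain ⟨_, ⟨y, hy, rfl⟩, h⟩ := h
        obtain ⟨rfl, -⟩ := Prod.mk.injEq _ _ _ _ ▸ h
        exact absurd (List.mem_of_mem_drop (List.mem_of_mem_take hy)) (inr_notMem_twoWayRow m j)
    · have hH : levelMorphism φ m idx a b x = drev ((levelImage φ m idx a b x).map (·, false)) :=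
        if_neg (by tauto)
      simp only [if_true, hH, drev_drev]
      exact ⟨hmap, hfalse⟩

lemma fDivides_of_levels {m n : ℕ} {idx a b : V → ℕ} (ha : ∀ x, TwoWay φ x → a x < m)
    (hp : ∀ p ∈ φ, ∃ c d, (twoWayRow m).take c ++ p.flatMap (fun z => levelImage φ m idx a b z.1)
      ++ (twoWayRow m).drop d = interleave m (oneWayIndices φ idx p))
    (hidx : ∀ p ∈ φ, oneWayIndices φ idx p <:+: ziminIndices n) :
    FDivides φ (ZiminRev m n) := by
  have hrow : (twoWayRow m).length = m := by simp [twoWayRow]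
  refine ⟨levelMorphism φ m idx a b, fun x => ?_, fun p hpφ => ?_⟩
  · have hI : levelImage φ m idx a b x ≠ [] := by
      unfold levelImage
      split_ifs with hx
      · have := ha x hx
        apply List.ne_nil_of_length_pos
        simp only [List.length_take, List.length_drop, hrow]
        omega
      · simp
    unfold levelMorphism
    split_ifs <;> simpa [drev] using hI
  · obtain ⟨c, d, hcd⟩ := hp p hpφ
    have hfst : (applyDRev (levelMorphism φ m idx a b) p).map Prod.fst =
        p.flatMap fun z => levelImage φ m idx a b z.1 := by
      rw [applyDRev, List.map_flatMap]
      exact List.flatMap_congr fun z hz => (levelMorphism_letter (appears_of_mem hpφ hz)).1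
    refine exists_mem_ziminRev_of_infix ?_ ?_
    · rw [hfst]
      exact List.IsInfix.trans ⟨_, _, hcd⟩ (interleave_infix (hidx p hpφ))
    · intro j e h
      rw [applyDRev, List.mem_flatMap] at h
      obtain ⟨z, hz, h⟩ := h
      exact (levelMorphism_letter (appears_of_mem hpφ hz)).2 j e h

lemma path_eq_interleave {α : Type*} {K m : ℕ} {hK : 0 < K} {s : ℕ → α}
    {h : V → List (Fin K × α)} {L : V → ℕ} {lev : ℕ → ℕ} (idx : V → ℕ)
    (hL : ∀ z, Appears φ z → ∀ i, OccursAt (blockWord K hK s) (letterImage h z) i →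
      i % K = L z.1)
    (hlen : ∀ x, TwoWay φ x → (h x).length = 1)
    (hlev : ∀ i j, i % K = j % K → lev i = lev j)
    (hstep : ∀ x, TwoWay φ x → ∀ i, i % K = L x → lev (i + 1) = lev i + 1)
    {p : List (V × Bool)} (hp : ∀ z ∈ p, Appears φ z) {i : ℕ}
    (hi : OccursAt (blockWord K hK s) (applyRev h p) i) :
    (twoWayRow m).take (lev i) ++ p.flatMap (fun z => levelImage φ m idx (fun x => lev (L x))
        (fun x => lev (L x + (h x).length)) z.1) ++
        (twoWayRow m).drop (lev (i + (applyRev h p).length)) =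
      interleave m (oneWayIndices φ idx p) := by
  induction p generalizing i with
  | nil => simp [applyRev, interleave, oneWayIndices]
  | cons z p ih =>
    rw [applyRev_cons_letterImage] at hi ⊢
    have hiL := hL z (hp z (by simp)) i hi.of_append.1
    have hLmod : L z.1 % K = i % K := by rw [← hiL, Nat.mod_mod]
    have ih' := ih (fun y hy => hp y (by simp [hy])) hi.of_append.2
    rw [List.length_append, ← add_assoc]
    rw [length_letterImage] at ih' ⊢
    rw [List.flatMap_cons]
    by_cases hz : TwoWay φ z.1
    · rw [hlen _ hz] at ih' ⊢
      have hI : oneWayIndices φ idx (z :: p) = oneWayIndices φ idx p := by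
        simp [oneWayIndices, hz]
      rw [hI, ← ih', hstep _ hz i hiL, List.take_add, levelImage, if_pos hz, hlev _ _ hLmod]
      simp only [List.append_assoc]
    · have hI : oneWayIndices φ idx (z :: p) = [] ++ idx z.1 :: oneWayIndices φ idx p := by
        simp [oneWayIndices, hz]
      have hend : lev (L z.1 + (h z.1).length) = lev (i + (h z.1).length) :=
        hlev _ _ (Nat.ModEq.add_right _ hLmod)
      rw [hI, interleave_append_cons, ← ih', levelImage, if_neg hz, hlev _ _ hLmod, hend]
      simp only [List.append_assoc, List.cons_append, interleave, List.flatMap_nil,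
        List.append_nil]
      rw [← List.append_assoc, List.take_append_drop]

lemma oneWayIndices_eq_append_cons {idx : V → ℕ} {p : List (V × Bool)} {σ τ : List ℕ} {j : ℕ}
    (h : oneWayIndices φ idx p = σ ++ j :: τ) :
    ∃ u z v, p = u ++ z :: v ∧ oneWayIndices φ idx u = σ ∧ ¬ TwoWay φ z.1 ∧ idx z.1 = j ∧
      oneWayIndices φ idx v = τ := by
  rw [oneWayIndices, List.filterMap_eq_append_iff] at h
  obtain ⟨u, r, rfl, hu, hr⟩ := h
  rw [List.filterMap_eq_cons_iff] at hr
  obtain ⟨l, z, v, rfl, hl, hz, hv⟩ := hr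
  have hz' : ¬ TwoWay φ z.1 ∧ idx z.1 = j := by
    by_cases h : TwoWay φ z.1 <;> simp_all
  refine ⟨u ++ l, z, v, by simp, ?_, hz'.1, hz'.2, hv⟩
  have hl' : l.filterMap (fun z => if TwoWay φ z.1 then none else some (idx z.1)) = [] :=
    List.filterMap_eq_nil_iff.mpr hl
  rw [oneWayIndices, List.filterMap_append, hu, hl', List.append_nil]

lemma twoWay_of_oneWayIndices_eq_nil {idx : V → ℕ} {u : List (V × Bool)}
    (h : oneWayIndices φ idx u = []) : ∀ z ∈ u, TwoWay φ z.1 := by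
  intro z hz
  have := List.filterMap_eq_nil_iff.mp h z hz
  by_contra hcon
  simp [hcon] at this

lemma infix_zero_of_no_square {σ : List ℕ} (h1 : ∀ j ∈ σ, j < 1) (h00 : ¬ [0, 0] <:+: σ) :
    σ <:+: [0] := by
  rcases σ with _ | ⟨a, _ | ⟨b, σ⟩⟩
  · exact List.nil_infix
  · obtain rfl : a = 0 := by have := h1 a (by simp); omega
    exact List.infix_refl _
  · obtain rfl : a = 0 := by have := h1 a (by simp); omega
    obtain rfl : b = 0 := by have := h1 b (by simp); omega
    exact absurd ⟨[], σ, rfl⟩ h00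

lemma infix_zero_one_zero {σ : List ℕ} (h2 : ∀ j ∈ σ, j < 2) (hsq : ∀ j, ¬ [j, j] <:+: σ)
    (h101 : ¬ [1, 0, 1] <:+: σ) : σ <:+: [0, 1, 0] := by
  have hsucc : ∀ a b τ τ', σ = τ ++ a :: b :: τ' → b = 1 - a := by
    rintro a b τ τ' rfl
    have ha := h2 a (by simp)
    have hb := h2 b (by simp)
    have hab : a ≠ b := by
      rintro rfl
      exact hsq a ⟨τ, τ', by simp⟩
    omega
  rcases σ with _ | ⟨a, σ⟩
  · exact List.nil_infix
  have ha : a = 0 ∨ a = 1 := by have := h2 a (by simp); omega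
  rcases σ with _ | ⟨b, σ⟩
  · rcases ha with rfl | rfl <;> decide
  obtain rfl := hsucc a b [] σ rfl
  rcases σ with _ | ⟨c, σ⟩
  · rcases ha with rfl | rfl <;> decide
  obtain rfl := hsucc _ c [a] σ rfl
  rcases ha with rfl | rfl
  · rcases σ with _ | ⟨d, σ⟩
    · decide
    · obtain rfl := hsucc _ d [0, 1] σ rfl
      exact absurd ⟨[0], σ, rfl⟩ h101
  · exact absurd ⟨[], σ, rfl⟩ h101

/-- The labelling of at most two one-way variables for which the ones with longer images get
larger labels. -/
lemma exists_index (S : Set V) (len : V → ℕ) {n : ℕ} (hn : n ≤ 2) (hS : S.ncard = n)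
    [Finite V] :
    ∃ idx : V → ℕ, Set.InjOn idx S ∧ (∀ x ∈ S, idx x < n) ∧
      ∀ x ∈ S, ∀ y ∈ S, idx x < idx y → len x ≤ len y := by
  interval_cases n
  · obtain rfl := (Set.ncard_eq_zero).mp hS
    exact ⟨fun _ => 0, by simp⟩
  · obtain ⟨y, rfl⟩ := Set.ncard_eq_one.mp hS
    exact ⟨fun _ => 0, by simp⟩
  · obtain ⟨y, z, hyz, rfl⟩ := Set.ncard_eq_two.mp hS
    wlog hle : len y ≤ len z generalizing y z
    · rw [Set.pair_comm] at hS ⊢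
      exact this z y hyz.symm hS (by omega)
    · refine ⟨fun x => if x = y then 0 else 1, ?_, ?_, ?_⟩
      · rintro x (rfl | rfl) x' (rfl | rfl) <;> simp [hyz, hyz.symm]
      · intro x _; dsimp only; split_ifs <;> omega
      · rintro x (rfl | rfl) x' (rfl | rfl) <;> simp [hyz.symm, hle]

lemma oneWayIndices_infix_ziminIndices {A : Type*} {h : V → List A} {C n : ℕ} (hn : n ≤ 2)
    {idx : V → ℕ} (hinj : Set.InjOn idx {x | OneWay φ x}) (hlt : ∀ x, OneWay φ x → idx x < n)
    (hmono : ∀ x, OneWay φ x → ∀ y, OneWay φ y → idx x < idx y → (h x).length ≤ (h y).length)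
    (hlen : ∀ x, TwoWay φ x → (h x).length = 1) (hC : ∀ p ∈ φ, p.length ≤ C)
    (hrep : ∀ a z u c, a ++ z :: (u ++ z :: c) ∈ φ →
      (h z.1).length + C < (applyRev h u).length)
    {p : List (V × Bool)} (hp : p ∈ φ) : oneWayIndices φ idx p <:+: ziminIndices n := by
  have hbound : ∀ j ∈ oneWayIndices φ idx p, j < n := by
    intro j hj
    obtain ⟨σ, τ, hστ⟩ := List.append_of_mem hj
    obtain ⟨u, z, v, rfl, -, hz, rfl, -⟩ := oneWayIndices_eq_append_cons hστ
    exact hlt _ (oneWay_of_appears (appears_of_mem hp (by simp)) hz)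
  have heq : ∀ z ∈ p, ∀ z' ∈ p, ¬ TwoWay φ z.1 → ¬ TwoWay φ z'.1 → idx z.1 = idx z'.1 →
      z = z' := fun z hz z' hz' h1 h2 h3 =>
    eq_of_appears_of_not_twoWay (appears_of_mem hp hz) (appears_of_mem hp hz') h1
      (hinj (oneWay_of_appears (appears_of_mem hp hz) h1)
        (oneWay_of_appears (appears_of_mem hp hz') h2) h3)
  have hsq : ∀ j, ¬ [j, j] <:+: oneWayIndices φ idx p := by
    rintro j ⟨σ, τ, h0⟩
    rw [List.append_assoc] at h0
    obtain ⟨a, z, v, rfl, -, hz, hj, hv⟩ := oneWayIndices_eq_append_cons h0.symm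
    obtain ⟨u, z', c, rfl, hu, hz', hj', -⟩ := oneWayIndices_eq_append_cons (σ := []) hv
    obtain rfl := heq z (by simp) z' (by simp) hz hz' (hj.trans hj'.symm)
    have h1 := hrep a z u c hp
    rw [length_applyRev_of_length_one fun y hy =>
      hlen _ (twoWay_of_oneWayIndices_eq_nil hu y hy)] at h1
    have h2 := hC _ hp
    simp only [List.length_append, List.length_cons] at h2
    omega
  have h101 : ¬ [1, 0, 1] <:+: oneWayIndices φ idx p := by
    rintro ⟨σ, τ, h0⟩
    rw [List.append_assoc] at h0
    obtain ⟨a, z, v, rfl, -, hz, hj, hv⟩ := oneWayIndices_eq_append_cons h0.symm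
    obtain ⟨u, y, v', rfl, hu, hy, hjy, hv'⟩ := oneWayIndices_eq_append_cons (σ := []) hv
    obtain ⟨u', z', c, rfl, hu', hz', hj', -⟩ := oneWayIndices_eq_append_cons (σ := []) hv'
    obtain rfl := heq z (by simp) z' (by simp) hz hz' (hj.trans hj'.symm)
    have h1 := hrep a z (u ++ y :: u') c (by simpa using hp)
    rw [applyRev_append, applyRev_cons_letterImage, List.length_append, List.length_append,
      length_letterImage,
      length_applyRev_of_length_one fun x hx => hlen _ (twoWay_of_oneWayIndices_eq_nil hu x hx),
      length_applyRev_of_length_one fun x hx =>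
        hlen _ (twoWay_of_oneWayIndices_eq_nil hu' x hx)] at h1
    have h2 := hC _ hp
    simp only [List.length_append, List.length_cons] at h2
    have h3 := hmono y.1 (oneWay_of_appears (appears_of_mem hp (by simp)) hy) z.1
      (oneWay_of_appears (appears_of_mem hp (by simp)) hz) (by omega)
    omega
  interval_cases n
  · rw [List.eq_nil_iff_forall_not_mem.mpr fun j hj => absurd (hbound j hj) (by omega)]
    exact List.nil_infix
  · exact infix_zero_of_no_square hbound (hsq 0)
  · exact infix_zero_one_zero hbound hsq h101

lemma fDivides_of_not_fAvoidable [Finite V] (hfin : φ.Finite) {m n : ℕ} (hn : n ≤ 2)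
    (hm : {x : V | TwoWay φ x}.ncard = m) (hone : {x : V | OneWay φ x}.ncard = n)
    (hφ : ¬ FAvoidable φ) : FDivides φ (ZiminRev m n) := by
  obtain ⟨C, hC⟩ : ∃ C, ∀ p ∈ φ, p.length ≤ C := by
    obtain ⟨C, hC⟩ := (hfin.image List.length).bddAbove
    exact ⟨C, fun p hp => hC ⟨p, hp, rfl⟩⟩
  set K := 2 * C + m + 3 with hKdef
  have hK : 0 < K := by omega
  choose s hs using exists_seq_no_sesquipower
  obtain ⟨N, h, hne, hinf⟩ :
      ∃ N, OccursIn φ ((List.range (N * K)).map (blockWord K hK (s N))) := by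
    by_contra! hcon
    refine hφ ⟨Fin K × Fin 8, inferInstance, Set.infinite_of_injective_forall_mem
      (f := fun N => (List.range (N * K)).map (blockWord K hK (s N))) ?_ hcon⟩
    intro N N' hNN
    have := congrArg List.length hNN
    simp only [List.length_map, List.length_range] at this
    exact Nat.eq_of_mul_eq_mul_right hK this
  have hocc : ∀ p ∈ φ, ∃ i, i + (applyRev h p).length ≤ N * K ∧
      OccursAt (blockWord K hK (s N)) (applyRev h p) i :=
    fun p hp => exists_occursAt_of_infix (hinf p hp)
  have hocc' : ∀ p ∈ φ, ∃ i, OccursAt (blockWord K hK (s N)) (applyRev h p) i :=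
    fun p hp => (hocc p hp).imp fun _ => And.right
  have hlen : ∀ x, TwoWay φ x → (h x).length = 1 :=
    fun x hx => length_eq_one_of_twoWay (by omega) hne hocc' hx
  obtain ⟨L, hL⟩ := exists_start_residue (hK := hK) (s := s N) hne hlen
  have hT : {x : V | TwoWay φ x}.Finite := Set.toFinite _
  obtain ⟨lev, hlev, hle, hstep⟩ := exists_level (K := K) (m := m) (hT.toFinset.image L)
    (Finset.card_image_le.trans (by rw [← Set.ncard_eq_toFinset_card _ hT, hm])) (by omega)
  have hstep' : ∀ x, TwoWay φ x → ∀ i, i % K = L x → lev (i + 1) = lev i + 1 := by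
    intro x hx i hi
    refine hstep i ?_
    rw [hi]
    exact Finset.mem_image_of_mem L (hT.mem_toFinset.mpr hx)
  obtain ⟨idx, hinj, hlt, hmono⟩ := exists_index {x | OneWay φ x} (fun x => (h x).length) hn hone
  refine fDivides_of_levels (idx := idx) (a := fun x => lev (L x))
    (b := fun x => lev (L x + (h x).length)) ?_ ?_ ?_
  · intro x hx
    obtain ⟨i, hi⟩ := exists_occursAt_letterImage hocc' hx.1
    have hiL := hL _ hx.1 i hi
    have h1 := hstep' x hx i hiL
    have h2 := hle (i + 1)
    have h3 : lev (L x) = lev i := hlev _ _ (by rw [← hiL, Nat.mod_mod])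
    omega
  · intro p hp
    obtain ⟨i, hi⟩ := hocc' p hp
    exact ⟨_, _, path_eq_interleave idx hL hlen hlev hstep' (fun z hz => appears_of_mem hp hz) hi⟩
  · intro p hp
    refine oneWayIndices_infix_ziminIndices hn hinj hlt hmono hlen hC ?_ hp
    intro a z u c hmem
    obtain ⟨i, hiN, hi⟩ := hocc _ hmem
    rw [applyRev_append, applyRev_cons_letterImage, applyRev_append,
      applyRev_cons_letterImage] at hi hiN
    have hz1 := hi.of_append.2.of_append.1
    have hz2 := hi.of_append.2.of_append.2.of_append.2.of_append.1
    simp only [List.length_append, length_letterImage] at hiN hz1 hz2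
    have hpos := List.length_pos_iff.mpr (hne z.1)
    have := period_gt_of_blockWord_repeat (hK := hK) (s := s N) (C := C) (by omega) (hs N)
      (i := i + (applyRev h a).length) (P := (h z.1).length + (applyRev h u).length)
      (ℓ := (h z.1).length) (by omega) hpos (by omega) (by
        intro j hj
        rw [← length_letterImage] at hj
        rw [← hz1 j hj, hz2 j hj]
        congr 1
        ring)
    omega

end Division

/-- A formula with reversal with exactly `m ≥ 0` two-way variables
and exactly `n ≤ 2` one-way variables is unavoidable if and only if it divides the
Zimin formula with reversal `Z_{m,n}`. -/
theorem unavoidable_iff_divides_ziminRev {V : Type*} [Finite V]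
    (φ : Set (List (V × Bool))) (hfin : φ.Finite) (hfrag : ∀ p ∈ φ, p ≠ [])
    (m n : ℕ) (hn : n ≤ 2)
    (hm : {x : V | TwoWay φ x}.ncard = m)
    (hone : {x : V | OneWay φ x}.ncard = n) :
    ¬ FAvoidable φ ↔ FDivides φ (ZiminRev m n) := by
  exact ⟨fDivides_of_not_fAvoidable hfin hn hm hone, not_fAvoidable_of_fDivides⟩
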